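/- Let d ≥ 1 and let Λ = Aℤ^d ⊂ ℝ^d be a Bravais lattice with A invertible. Let γ₁ > 0, γ₂ > 0 and let γ̃ ∈ (0, min(γ₁, γ₂)). Then there exists a constant C > 0, depending only on d, A, γ₁, γ₂ and γ̃, such that for all x, y ∈ ℝ^d, the lattice sum Σ_{p ∈ Λ} e^{−γ₁ |x−p|} e^{−γ₂ |p−y|} converges and satisfies Σ_{p ∈ Λ} e^{−γ₁ |x−p|} e^{−γ₂ |p−y|} ≤ C e^{−γ̃ |x−y|}. -/

import Mathlib

noncomputable section

/-- The position in `ℝ^d` (with the Euclidean norm) of the lattice site `A m`, `m ∈ ℤ^d`,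
of the Bravais lattice `Λ = A ℤ^d`. -/
def latPos {d : ℕ} (A : Matrix (Fin d) (Fin d) ℝ) (m : Fin d → ℤ) :
    EuclideanSpace ℝ (Fin d) :=
  (WithLp.equiv 2 (Fin d → ℝ)).symm (A.mulVec fun i => (m i : ℝ))

/-- A product of nonnegative summable functions of separate variables is summable. -/
theorem summable_fin_pi_prod {α : Type*} {f : α → ℝ} (hf : Summable f) (hf0 : ∀ a, 0 ≤ f a)
    (d : ℕ) : Summable fun p : Fin d → α => ∏ i, f (p i) := by
  induction d with
  | zero => exact .of_finite
  | succ d ih =>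
    rw [← (Fin.consEquiv fun _ : Fin (d + 1) => α).summable_iff]
    refine (hf.mul_of_nonneg ih hf0 fun p => Finset.prod_nonneg fun i _ => hf0 (p i)).congr ?_
    intro p
    simp [Fin.prod_univ_succ, Fin.consEquiv]

theorem summable_exp_neg_mul_abs_int {c : ℝ} (hc : 0 < c) :
    Summable fun n : ℤ => Real.exp (-c * |(n : ℝ)|) := by
  have h : Summable fun n : ℕ => Real.exp (-c * |(n : ℝ)|) := by
    refine (Real.summable_exp_nat_mul_iff.mpr (neg_lt_zero.mpr hc)).congr fun n => ?_
    rw [Nat.abs_cast, mul_comm]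
  exact .of_nat_of_neg (by simpa using h) (by simpa using h)

/-- For invertible `A`, distances to the lattice `A ℤ^d` control the coordinates of the
difference with respect to the columns of `A`. -/
theorem exists_abs_sub_le_norm_sub_latPos {d : ℕ} {A : Matrix (Fin d) (Fin d) ℝ}
    (hA : IsUnit A.det) :
    ∃ K : ℝ, 0 < K ∧ ∀ (x : EuclideanSpace ℝ (Fin d)) (p : Fin d → ℤ) (i : Fin d),
      |A⁻¹.mulVec x.ofLp i - p i| ≤ K * ‖x - latPos A p‖ := by
  let L : EuclideanSpace ℝ (Fin d) →L[ℝ] (Fin d → ℝ) :=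
    (A⁻¹.mulVecLin ∘ₗ (WithLp.linearEquiv 2 ℝ (Fin d → ℝ)).toLinearMap).toContinuousLinearMap
  obtain ⟨K, hK, hL⟩ := L.bound
  refine ⟨K, hK, fun x p i => ?_⟩
  have hLi : L (x - latPos A p) i = A⁻¹.mulVec x.ofLp i - p i := by
    change A⁻¹.mulVec (x.ofLp - A.mulVec fun i => (p i : ℝ)) i = _
    rw [Matrix.mulVec_sub, Matrix.mulVec_mulVec, Matrix.nonsing_inv_mul A hA, Matrix.one_mulVec,
      Pi.sub_apply]
  rw [← hLi, ← Real.norm_eq_abs]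
  exact (norm_le_pi_norm _ i).trans (hL _)

/-- Exponential sums over the lattice `A ℤ^d` are bounded uniformly in the centre. -/
theorem exists_tsum_exp_neg_mul_norm_sub_latPos_le {d : ℕ} {A : Matrix (Fin d) (Fin d) ℝ}
    (hA : IsUnit A.det) {δ : ℝ} (hδ : 0 < δ) :
    ∃ C : ℝ, 0 < C ∧ ∀ x : EuclideanSpace ℝ (Fin d),
      Summable (fun p : Fin d → ℤ => Real.exp (-δ * ‖x - latPos A p‖)) ∧
      ∑' p : Fin d → ℤ, Real.exp (-δ * ‖x - latPos A p‖) ≤ C := by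
  obtain ⟨K, hK, hbound⟩ := exists_abs_sub_le_norm_sub_latPos hA
  set c : ℝ := δ / (K * (d + 1))
  have hc : 0 < c := by positivity
  let G : (Fin d → ℤ) → ℝ := fun q => ∏ i, Real.exp (-c * |(q i : ℝ)|)
  have hG : Summable G :=
    summable_fin_pi_prod (summable_exp_neg_mul_abs_int hc) (fun _ => (Real.exp_pos _).le) d
  have hG0 : 0 < ∑' q, G q :=
    hG.tsum_pos (fun q => Finset.prod_nonneg fun i _ => (Real.exp_pos _).le) 0
      (Finset.prod_pos fun i _ => Real.exp_pos _)
  refine ⟨Real.exp (d * c) * ∑' q, G q, by positivity, fun x => ?_⟩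
  let m : Fin d → ℤ := fun i => round (A⁻¹.mulVec x.ofLp i)
  have hle : ∀ p, Real.exp (-δ * ‖x - latPos A p‖) ≤ Real.exp (d * c) * G (p - m) := by
    intro p
    simp only [G, ← Real.exp_sum, ← Real.exp_add, Real.exp_le_exp, ← Finset.mul_sum]
    have hsum : ∑ i, |((p - m) i : ℝ)| ≤ d * (K * ‖x - latPos A p‖ + 1) := by
      calc ∑ i, |((p - m) i : ℝ)| ≤ ∑ _i : Fin d, (K * ‖x - latPos A p‖ + 1) := by
            refine Finset.sum_le_sum fun i _ => ?_
            have h₁ := hbound x p i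
            have h₂ : |A⁻¹.mulVec x.ofLp i - m i| ≤ 1 / 2 := abs_sub_round _
            rw [Pi.sub_apply, Int.cast_sub, abs_sub_comm]
            have h₃ := abs_sub_le (m i : ℝ) (A⁻¹.mulVec x.ofLp i) (p i)
            rw [abs_sub_comm (m i : ℝ) (A⁻¹.mulVec x.ofLp i)] at h₃
            linarith
        _ = d * (K * ‖x - latPos A p‖ + 1) := by simp [mul_add]
    have hcd : c * (K * (d + 1)) = δ := div_mul_cancel₀ _ (by positivity)
    have hmul := mul_le_mul_of_nonneg_left hsum hc.le
    have hrest : 0 ≤ c * K * ‖x - latPos A p‖ := by positivity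
    rw [← hcd]
    linarith
  have hshift : Summable fun p => Real.exp (d * c) * G (p - m) :=
    ((Equiv.subRight m).summable_iff.mpr hG).mul_left _
  have hsummable := Summable.of_nonneg_of_le (fun p => (Real.exp_pos _).le) hle hshift
  refine ⟨hsummable, (hsummable.tsum_le_tsum hle hshift).trans_eq ?_⟩
  rw [tsum_mul_left]
  exact congrArg _ ((Equiv.subRight m).tsum_eq G)

/-- Discrete convolution estimate: the lattice sum `Σ_{p ∈ Λ} e^{-γ₁|x-p|} e^{-γ₂|p-y|}`
converges and is bounded by `C e^{-γ̃|x-y|}` for any rate `γ̃ < min(γ₁, γ₂)`,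
with `C` depending only on `d`, `A`, `γ₁`, `γ₂`, `γ̃`. -/
theorem lattice_convolution_decay
    (d : ℕ) (hd : 1 ≤ d) (A : Matrix (Fin d) (Fin d) ℝ) (hA : IsUnit A.det)
    (γ₁ γ₂ γt : ℝ) (hγ₁ : 0 < γ₁) (hγ₂ : 0 < γ₂) (hγt : 0 < γt)
    (hγtlt : γt < min γ₁ γ₂) :
    ∃ C : ℝ, 0 < C ∧ ∀ x y : EuclideanSpace ℝ (Fin d),
      Summable (fun p : Fin d → ℤ =>
        Real.exp (-γ₁ * ‖x - latPos A p‖) * Real.exp (-γ₂ * ‖latPos A p - y‖)) ∧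
      ∑' p : Fin d → ℤ,
          Real.exp (-γ₁ * ‖x - latPos A p‖) * Real.exp (-γ₂ * ‖latPos A p - y‖) ≤
        C * Real.exp (-γt * ‖x - y‖) := by
  obtain ⟨h₁, h₂⟩ := lt_min_iff.mp hγtlt
  obtain ⟨C, hC, hsum⟩ := exists_tsum_exp_neg_mul_norm_sub_latPos_le hA (sub_pos.mpr h₁)
  refine ⟨C, hC, fun x y => ?_⟩
  obtain ⟨hs, hsC⟩ := hsum x
  have hle : ∀ p : Fin d → ℤ,
      Real.exp (-γ₁ * ‖x - latPos A p‖) * Real.exp (-γ₂ * ‖latPos A p - y‖) ≤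
        Real.exp (-(γ₁ - γt) * ‖x - latPos A p‖) * Real.exp (-γt * ‖x - y‖) := by
    intro p
    rw [← Real.exp_add, ← Real.exp_add, Real.exp_le_exp]
    have htri := mul_le_mul_of_nonneg_left (norm_sub_le_norm_sub_add_norm_sub x (latPos A p) y)
      hγt.le
    have hγ := mul_le_mul_of_nonneg_right h₂.le (norm_nonneg (latPos A p - y))
    linarith
  have hmajor := hs.mul_right (Real.exp (-γt * ‖x - y‖))
  have hsummable := Summable.of_nonneg_of_le (fun p => by positivity) hle hmajor
  refine ⟨hsummable, (hsummable.tsum_le_tsum hle hmajor).trans ?_⟩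
  rw [tsum_mul_right]
  gcongr
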